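/- Let α > 0 with α ≠ 1, let 0 < u_min ≤ u_max, set Θ = [−u_min^{−α}, −u_max^{−α}]^I ⊆ ℝ^I, let 𝒴 be any nonempty set, T ≥ 1, and for each t = 1,…,T let u_t : 𝒴 → [u_min, u_max]^I and c_t : 𝒴 → ℝ. Define the proxy function Ψ_t^c(θ, y) = Σ_{i=1}^I g_α(θ_i) − ⟨θ, u_t(y)⟩ − c_t(y), and define G_α for the sequence (y_t) by G_α((y_t)) = F_α( (1/T)Σ_{t=1}^T u_t(y_t) ) − (1/T)Σ_{t=1}^T c_t(y_t), and for a fixed point y* by G_α(y*) = F_α( (1/T)Σ_{t=1}^T u_t(y*) ) − (1/T)Σ_{t=1}^T c_t(y*). Let y₁,…,y_T ∈ 𝒴, θ₁,…,θ_T ∈ Θ, y* ∈ 𝒴, and θ̄ = (1/T)Σ_{t=1}^T θ_t. Assume the real numbers B_y and B_θ satisfy: (i) Σ_{t=1}^T [ Ψ_t^c(θ_t, y*) − Ψ_t^c(θ_t, y_t) ] ≤ B_y; (ii) Σ_{t=1}^T [ Ψ_t^c(θ_t, y_t) − Ψ_t^c(θ, y_t) ] ≤ B_θ for every θ ∈ Θ.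 Then G_α(y*) − G_α((y_t)) ≤ (B_y + B_θ)/T + (1/T)Σ_{t=1}^T ⟨θ_t − θ̄, u_t(y*)⟩. -/

import Mathlib

/-- The α-fairness function `f_α(u) = (u^{1−α} − 1)/(1−α)` (for `α ≠ 1`). -/
noncomputable def fAlpha (α u : ℝ) : ℝ := (u ^ (1 - α) - 1) / (1 - α)

/-- The vector α-fairness function `F_α(v) = ∑_k f_α(v_k)`. -/
noncomputable def FAlpha (α : ℝ) {K : ℕ} (v : Fin K → ℝ) : ℝ := ∑ k, fAlpha α (v k)

/-- The conjugate expression `g_α(θ) = (α·(−θ)^{1−1/α} − 1)/(1−α)` (for `α ≠ 1`, `θ < 0`). -/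
noncomputable def gAlpha (α θ : ℝ) : ℝ := (α * (-θ) ^ (1 - 1 / α) - 1) / (1 - α)

/-- The tangent-line bound at `1` for `r ^ (1 - α) / (1 - α)`, which is concave in `r`. -/
theorem rpow_div_le_div_add {α : ℝ} (hα : 0 < α) (hα1 : α ≠ 1) {r : ℝ} (hr : 0 < r) :
    r ^ (1 - α) / (1 - α) ≤ α / (1 - α) + r := by
  rcases lt_or_gt_of_ne hα1 with h | h
  · have hb := rpow_one_add_le_one_add_mul_self (s := r - 1) (p := 1 - α)
      (by linarith) (by linarith) (by linarith)
    rw [add_sub_cancel] at hb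
    have hp : 0 < 1 - α := by linarith
    rw [div_add' _ _ _ hp.ne', div_le_div_iff_of_pos_right hp]
    linarith
  · have hb : 1 + (1 - α) * (r - 1) ≤ r ^ (1 - α) := by
      rw [Real.rpow_def_of_pos hr]
      nlinarith [Real.add_one_le_exp (Real.log r * (1 - α)), Real.log_le_sub_one_of_pos hr]
    have hp : 1 - α < 0 := by linarith
    rw [div_add' _ _ _ hp.ne, div_le_div_right_of_neg hp]
    linarith

/-- At the dual point `-w ^ (-α)`, the conjugate expression is `(α * w ^ (1 - α) - 1) / (1 - α)`. -/
theorem gAlpha_neg_rpow {α : ℝ} (hα : 0 < α) {w : ℝ} (hw : 0 < w) :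
    gAlpha α (-w ^ (-α)) = (α * w ^ (1 - α) - 1) / (1 - α) := by
  have h : -α * (1 - 1 / α) = 1 - α := by field_simp; ring
  rw [gAlpha, neg_neg, ← Real.rpow_mul hw.le, h]

/-- The Fenchel–Young inequality for `fAlpha` and `gAlpha`. -/
theorem fAlpha_le_gAlpha_sub_mul {α : ℝ} (hα : 0 < α) (hα1 : α ≠ 1) {v θ : ℝ}
    (hv : 0 < v) (hθ : θ < 0) : fAlpha α v ≤ gAlpha α θ - θ * v := by
  obtain ⟨w, hw, rfl⟩ : ∃ w : ℝ, 0 < w ∧ θ = -w ^ (-α) := by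
    refine ⟨(-θ) ^ (-1 / α), Real.rpow_pos_of_pos (by linarith) _, ?_⟩
    have h : -1 / α * -α = 1 := by field_simp
    rw [← Real.rpow_mul (by linarith), h, Real.rpow_one, neg_neg]
  rw [gAlpha_neg_rpow hα hw, fAlpha]
  have hb := mul_le_mul_of_nonneg_left (rpow_div_le_div_add hα hα1 (div_pos hv hw))
    (Real.rpow_pos_of_pos hw (1 - α)).le
  have h₁ : w ^ (1 - α) * ((v / w) ^ (1 - α) / (1 - α)) = v ^ (1 - α) / (1 - α) := by
    rw [Real.div_rpow hv.le hw.le]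
    have := (Real.rpow_pos_of_pos hw (1 - α)).ne'
    field_simp
  have h₂ : w ^ (1 - α) * (v / w) = w ^ (-α) * v := by
    rw [sub_eq_add_neg, Real.rpow_add hw, Real.rpow_one]
    field_simp
  rw [mul_add, h₁, h₂, mul_div_assoc'] at hb
  rw [sub_div, sub_div, mul_comm α]
  linarith

/-- Equality in the Fenchel–Young inequality is attained at `θ = -v ^ (-α)`. -/
theorem gAlpha_sub_mul_eq_fAlpha {α : ℝ} (hα : 0 < α) (hα1 : α ≠ 1) {v : ℝ} (hv : 0 < v) :
    gAlpha α (-v ^ (-α)) - -v ^ (-α) * v = fAlpha α v := by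
  rw [gAlpha_neg_rpow hα hv, fAlpha]
  have h : v ^ (-α) * v = v ^ (1 - α) := by
    rw [sub_eq_add_neg, add_comm, Real.rpow_add hv, Real.rpow_one]
  rw [neg_mul, h]
  have : 1 - α ≠ 0 := sub_ne_zero.mpr hα1.symm
  field_simp
  ring

/-- An average of points of `[a, b]` lies in `[a, b]`. -/
theorem average_mem_Icc {T : ℕ} (hT : 1 ≤ T) {a b : ℝ} {x : ℕ → ℝ}
    (hx : ∀ t < T, x t ∈ Set.Icc a b) :
    (1 / T : ℝ) * ∑ t ∈ Finset.range T, x t ∈ Set.Icc a b := by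
  have hT0 : (0 : ℝ) < T := by exact_mod_cast hT
  have h₁ := Finset.card_nsmul_le_sum (Finset.range T) x a
    fun t ht => (hx t (Finset.mem_range.mp ht)).1
  have h₂ := Finset.sum_le_card_nsmul (Finset.range T) x b
    fun t ht => (hx t (Finset.mem_range.mp ht)).2
  rw [Finset.card_range, nsmul_eq_mul] at h₁ h₂
  rw [one_div_mul_eq_div]
  exact ⟨by rw [le_div_iff₀ hT0]; linarith, by rw [div_le_iff₀ hT0]; linarith⟩

/-- Saddle-point decomposition for the fair and cost-efficient `minTB` policy: the regret of
the combined objective `G_α = F_α(time-averaged utilities) − (time-averaged cost)` at a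
comparator `y*` is bounded by the primal proxy regret, the dual proxy regret, and the
deviation of the dual iterates from their time average.
`Ψ_t^c(θ, y) = ∑_i g_α(θ_i) − ⟨θ, u_t(y)⟩ − c_t(y)`. Slots are indexed `0, …, T−1`. -/
theorem minTB_fairness_cost_regret_decomposition
    {𝒴 : Type*} [Nonempty 𝒴] (I T : ℕ) (hT : 1 ≤ T)
    (α : ℝ) (hα : 0 < α) (hα1 : α ≠ 1)
    (umin umax : ℝ) (humin : 0 < umin) (huminmax : umin ≤ umax)
    (u : ℕ → 𝒴 → Fin I → ℝ) (c : ℕ → 𝒴 → ℝ)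
    (hu : ∀ t < T, ∀ y i, u t y i ∈ Set.Icc umin umax)
    (Ψc : ℕ → (Fin I → ℝ) → 𝒴 → ℝ)
    (hΨc : ∀ t θ y, Ψc t θ y = (∑ i, gAlpha α (θ i)) - (∑ i, θ i * u t y i) - c t y)
    (ys : ℕ → 𝒴) (θs : ℕ → Fin I → ℝ) (ystar : 𝒴)
    (hθs : ∀ t < T, ∀ i, θs t i ∈ Set.Icc (-umin ^ (-α)) (-umax ^ (-α)))
    (θbar : Fin I → ℝ) (hθbar : ∀ i, θbar i = (1 / T : ℝ) * ∑ t ∈ Finset.range T, θs t i)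
    (By Bθ : ℝ)
    (hBy : ∑ t ∈ Finset.range T, (Ψc t (θs t) ystar - Ψc t (θs t) (ys t)) ≤ By)
    (hBθ : ∀ θ : Fin I → ℝ, (∀ i, θ i ∈ Set.Icc (-umin ^ (-α)) (-umax ^ (-α))) →
      ∑ t ∈ Finset.range T, (Ψc t (θs t) (ys t) - Ψc t θ (ys t)) ≤ Bθ) :
    (FAlpha α (fun i => (1 / T : ℝ) * ∑ t ∈ Finset.range T, u t ystar i) -
        (1 / T : ℝ) * ∑ t ∈ Finset.range T, c t ystar) -
      (FAlpha α (fun i => (1 / T : ℝ) * ∑ t ∈ Finset.range T, u t (ys t) i) -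
        (1 / T : ℝ) * ∑ t ∈ Finset.range T, c t (ys t)) ≤
    (By + Bθ) / T +
      (1 / T : ℝ) * ∑ t ∈ Finset.range T, ∑ i, (θs t i - θbar i) * u t ystar i := by
  have hT0 : (0 : ℝ) < T := by exact_mod_cast hT
  have havg : ∀ y : ℕ → 𝒴, ∀ i,
      (1 / T : ℝ) * ∑ t ∈ Finset.range T, u t (y t) i ∈ Set.Icc umin umax :=
    fun y i => average_mem_Icc hT fun t ht => hu t ht (y t) i
  set v : Fin I → ℝ := fun i => (1 / T : ℝ) * ∑ t ∈ Finset.range T, u t ystar i with hv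
  set w : Fin I → ℝ := fun i => (1 / T : ℝ) * ∑ t ∈ Finset.range T, u t (ys t) i with hw
  have hvI : ∀ i, v i ∈ Set.Icc umin umax := havg fun _ => ystar
  have hwI : ∀ i, w i ∈ Set.Icc umin umax := havg ys
  have hvT : ∀ i, ∑ t ∈ Finset.range T, u t ystar i = T * v i := fun i => by
    simp only [hv]; field_simp
  have hwT : ∀ i, ∑ t ∈ Finset.range T, u t (ys t) i = T * w i := fun i => by
    simp only [hw]; field_simp
  have hθT : ∀ i, ∑ t ∈ Finset.range T, θs t i = T * θbar i := fun i => by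
    rw [hθbar]; field_simp
  -- The comparator is bounded by averaging the Fenchel–Young inequality over the dual iterates.
  have hstar : T * FAlpha α v - ∑ t ∈ Finset.range T, c t ystar ≤
      ∑ t ∈ Finset.range T, Ψc t (θs t) ystar +
        ∑ t ∈ Finset.range T, ∑ i, (θs t i - θbar i) * u t ystar i := by
    have hFY : ∑ t ∈ Finset.range T, FAlpha α v ≤
        ∑ t ∈ Finset.range T, ∑ i, (gAlpha α (θs t i) - θs t i * v i) := by
      refine Finset.sum_le_sum fun t ht => Finset.sum_le_sum fun i _ => ?_
      have hneg : θs t i < 0 := (hθs t (Finset.mem_range.mp ht) i).2.trans_lt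
        (neg_neg_of_pos (Real.rpow_pos_of_pos (humin.trans_le huminmax) _))
      exact fAlpha_le_gAlpha_sub_mul hα hα1 (humin.trans_le (hvI i).1) hneg
    have hswap : ∑ t ∈ Finset.range T, ∑ i, θs t i * v i =
        ∑ t ∈ Finset.range T, ∑ i, θbar i * u t ystar i := by
      rw [Finset.sum_comm, Finset.sum_comm (s := Finset.range T)]
      refine Finset.sum_congr rfl fun i _ => ?_
      rw [← Finset.sum_mul, ← Finset.mul_sum, hθT, hvT]
      ring
    simp only [Finset.sum_const, Finset.card_range, nsmul_eq_mul,
      Finset.sum_sub_distrib] at hFY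
    simp only [hΨc, sub_mul, Finset.sum_sub_distrib]
    linarith
  -- The played sequence attains equality at the dual point of its average utility.
  have hplay : ∑ t ∈ Finset.range T, Ψc t (fun i => -w i ^ (-α)) (ys t) =
      T * FAlpha α w - ∑ t ∈ Finset.range T, c t (ys t) := by
    have hswap : ∑ t ∈ Finset.range T, ∑ i, -w i ^ (-α) * u t (ys t) i =
        T * ∑ i, -w i ^ (-α) * w i := by
      rw [Finset.sum_comm, Finset.mul_sum]
      refine Finset.sum_congr rfl fun i _ => ?_
      rw [← Finset.mul_sum, hwT]
      ring
    have hF : FAlpha α w = ∑ i, gAlpha α (-w i ^ (-α)) - ∑ i, -w i ^ (-α) * w i := by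
      rw [← Finset.sum_sub_distrib]
      exact Finset.sum_congr rfl fun i _ =>
        (gAlpha_sub_mul_eq_fAlpha hα hα1 (humin.trans_le (hwI i).1)).symm
    simp only [hΨc, Finset.sum_sub_distrib, hswap, Finset.sum_const, Finset.card_range,
      nsmul_eq_mul, hF]
    ring
  have hdual := hBθ (fun i => -w i ^ (-α)) fun i =>
    ⟨neg_le_neg (Real.rpow_le_rpow_of_nonpos humin (hwI i).1 (by linarith)),
      neg_le_neg (Real.rpow_le_rpow_of_nonpos (humin.trans_le (hwI i).1) (hwI i).2
        (by linarith))⟩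
  rw [Finset.sum_sub_distrib] at hdual hBy
  rw [one_div_mul_eq_div, one_div_mul_eq_div, one_div_mul_eq_div, ← add_div, le_div_iff₀ hT0,
    sub_mul, sub_mul, sub_mul, div_mul_cancel₀ _ hT0.ne', div_mul_cancel₀ _ hT0.ne']
  linarith
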